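/- arXiv:2105.05084 — 2 statements merged into one kernel-verified Lean document; each statement's English description precedes it below -/
import Mathlib

section
/- Let p > 0 and let T be a compact interval (a product of compact intervals) in ℝ^{1+N}, with coordinates written (t, x) ∈ ℝ × ℝ^N. If αp < 1 + N, then there exists a constant C < ∞ such that for all compact subintervals I ⊆ T, all integers n ≥ 1 and all points (t¹, x¹), …, (tⁿ, xⁿ) ∈ I: ∫_I [ ∫_{S^{N−1}} min_{1≤i≤n} |(t + ⟨x, w⟩) − (t^i + ⟨x^i, w⟩)|^{2α} dσ(w) ]^{−p/2} dt dx ≤ C n^{αp} [λ_{1+N}(I)]^{1 − αp/(1+N)}. -/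
open MeasureTheory Set
open scoped ENNReal

/-- The surface measure `σ` on the unit sphere `S^{N−1} ⊂ ℝ^N`. -/
noncomputable def sphMeasure (N : ℕ) :
    Measure (Metric.sphere (0 : EuclideanSpace ℝ (Fin N)) 1) :=
  (volume : Measure (EuclideanSpace ℝ (Fin N))).toSphere

/-- The linear map `q ↦ (t + ⟨x, W_k⟩)_k`. -/
noncomputable def bMap (N : ℕ) (W : Fin (N + 1) → EuclideanSpace ℝ (Fin N)) :
    (ℝ × EuclideanSpace ℝ (Fin N)) →L[ℝ] (ℝ × EuclideanSpace ℝ (Fin N)) :=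
  LinearMap.toContinuousLinearMap
    { toFun := fun q => (q.1 + inner ℝ q.2 (W 0),
        WithLp.toLp 2 fun i => q.1 + inner ℝ q.2 (W i.succ))
      map_add' := by
        intro a b
        ext i
        · simp [inner_add_left]; ring
        · simp [inner_add_left]; ring
      map_smul' := by
        intro c a
        ext i
        · simp [inner_smul_left]; ring
        · simp [inner_smul_left]; ring }

lemma bMap_apply (N : ℕ) (W : Fin (N + 1) → EuclideanSpace ℝ (Fin N))
    (q : ℝ × EuclideanSpace ℝ (Fin N)) :
    bMap N W q = (q.1 + inner ℝ q.2 (W 0),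
        WithLp.toLp 2 fun i => q.1 + inner ℝ q.2 (W i.succ)) := rfl

lemma continuous_bMap (N : ℕ) : Continuous (bMap N) := by
  rw [continuous_clm_apply]
  intro q
  simp only [bMap_apply]
  fun_prop

lemma exists_nonsing (N : ℕ) (hN : 1 ≤ N) :
    ∃ W : Fin (N + 1) → Metric.sphere (0 : EuclideanSpace ℝ (Fin N)) 1,
      (bMap N (fun k => (W k : EuclideanSpace ℝ (Fin N)))).det ≠ 0 := by
  let i0 : Fin N := ⟨0, hN⟩
  refine ⟨Fin.cases ⟨-EuclideanSpace.single i0 1, by simp⟩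
    (fun i => ⟨EuclideanSpace.single i 1, by simp⟩), ?_⟩
  intro h
  have h2 := LinearMap.bot_lt_ker_of_det_eq_zero h
  obtain ⟨q, hq, hq0⟩ := (Submodule.ne_bot_iff _).1 h2.ne'
  apply hq0
  have hq' := LinearMap.mem_ker.1 hq
  rw [ContinuousLinearMap.coe_coe, bMap_apply] at hq'
  have e1 := congrArg Prod.fst hq'
  have e2 : ∀ i, q.1 + q.2 i = 0 := by
    intro i
    have := congrArg (fun r => r.2 i) hq'
    simpa [EuclideanSpace.inner_single_right] using this
  have e1' : q.1 - q.2 i0 = 0 := by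
    simpa [sub_eq_add_neg, EuclideanSpace.inner_single_right] using e1
  have e3 : q.1 = 0 := by linarith [e2 i0]
  ext i
  · exact e3
  · have := e2 i
    simp; linarith

lemma exists_nbhd (N : ℕ) (hN : 1 ≤ N) :
    ∃ c : ℝ, 0 < c ∧ ∃ U : Fin (N + 1) → Set (Metric.sphere (0 : EuclideanSpace ℝ (Fin N)) 1),
      (∀ k, IsOpen (U k) ∧ (U k).Nonempty) ∧
      ∀ W : Fin (N + 1) → Metric.sphere (0 : EuclideanSpace ℝ (Fin N)) 1, (∀ k, W k ∈ U k) →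
        c ≤ |(bMap N (fun k => (W k : EuclideanSpace ℝ (Fin N)))).det| := by
  obtain ⟨W0, hW0⟩ := exists_nonsing N hN
  have hc : Continuous (fun W : Fin (N + 1) → Metric.sphere (0 : EuclideanSpace ℝ (Fin N)) 1 =>
      |(bMap N (fun k => (W k : EuclideanSpace ℝ (Fin N)))).det|) := by
    have h1 : Continuous (fun W : Fin (N + 1) → Metric.sphere (0 : EuclideanSpace ℝ (Fin N)) 1 =>
      (fun k => (W k : EuclideanSpace ℝ (Fin N)))) := by fun_prop
    exact (ContinuousLinearMap.continuous_det.comp ((continuous_bMap N).comp h1)).abs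
  have hpos := abs_pos.2 hW0
  refine ⟨_, half_pos hpos, ?_⟩
  have ho := isOpen_lt (continuous_const (y := |(bMap N (fun k => (W0 k : EuclideanSpace ℝ (Fin N)))).det| / 2)) hc
  rw [isOpen_pi_iff'] at ho
  obtain ⟨u, hu, hs⟩ := ho W0 (half_lt_self hpos)
  refine ⟨u, fun k => ⟨(hu k).1, ⟨_, (hu k).2⟩⟩, fun W hW => ?_⟩
  exact le_of_lt (hs (fun k _ => hW k))

/-- volume of the preimage of a box -/
lemma volume_box_preimage (N : ℕ) (W : Fin (N + 1) → EuclideanSpace ℝ (Fin N))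
    (c : ℝ) (hc : 0 < c) (hW : c ≤ |(bMap N W).det|) (A : Fin (N + 1) → Set ℝ)
    (hA : ∀ k, MeasurableSet (A k)) (v : ℝ≥0∞) (hv : ∀ k, volume (A k) ≤ v) :
    volume {q : ℝ × EuclideanSpace ℝ (Fin N) | ∀ k, q.1 + inner ℝ q.2 (W k) ∈ A k} ≤
      ENNReal.ofReal c⁻¹ * v ^ (N + 1) := by
  have h0 : (bMap N W).det ≠ 0 := by
    intro h; rw [h] at hW; simp at hW; linarith
  have hset : {q : ℝ × EuclideanSpace ℝ (Fin N) | ∀ k, q.1 + inner ℝ q.2 (W k) ∈ A k} =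
      (bMap N W) ⁻¹' ((A 0) ×ˢ (WithLp.ofLp ⁻¹' (univ.pi fun i : Fin N => A i.succ))) := by
    ext q
    simp [bMap_apply, Fin.forall_fin_succ]
  have hbox : volume ((WithLp.ofLp : EuclideanSpace ℝ (Fin N) → (Fin N → ℝ)) ⁻¹'
      (univ.pi fun i : Fin N => A i.succ)) = ∏ i : Fin N, volume (A i.succ) := by
    rw [← volume_pi_pi]
    exact (EuclideanSpace.volume_preserving_symm_measurableEquiv_toLp (Fin N)).measure_preimage
      (MeasurableSet.univ_pi fun i : Fin N => hA i.succ).nullMeasurableSet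
  have : (volume : Measure (ℝ × EuclideanSpace ℝ (Fin N))).IsAddHaarMeasure :=
    Measure.prod.instIsAddHaarMeasure _ _
  rw [hset, Measure.addHaar_preimage_continuousLinearMap _ h0, Measure.volume_eq_prod,
    Measure.prod_prod, 
    hbox, pow_succ']
  gcongr
  · rw [abs_inv]; gcongr
  · exact hv 0
  · calc _ ≤ ∏ i : Fin N, v := Finset.prod_le_prod' fun i _ => hv _
      _ = _ := by simp

lemma measurable_g (N n : ℕ) (α : ℝ) (z : Fin n → ℝ × EuclideanSpace ℝ (Fin N)) :
    Measurable (fun r : (ℝ × EuclideanSpace ℝ (Fin N)) ×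
        Metric.sphere (0 : EuclideanSpace ℝ (Fin N)) 1 =>
      ENNReal.ofReal (⨅ i, |(r.1.1 + (inner ℝ r.1.2 (r.2 : EuclideanSpace ℝ (Fin N)) : ℝ)) -
        ((z i).1 + (inner ℝ (z i).2 (r.2 : EuclideanSpace ℝ (Fin N)) : ℝ))| ^ (2 * α))) := by
  apply Measurable.ennreal_ofReal
  apply Measurable.iInf
  intro i
  have : Continuous (fun r : (ℝ × EuclideanSpace ℝ (Fin N)) ×
        Metric.sphere (0 : EuclideanSpace ℝ (Fin N)) 1 =>
      |(r.1.1 + (inner ℝ r.1.2 (r.2 : EuclideanSpace ℝ (Fin N)) : ℝ)) -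
        ((z i).1 + (inner ℝ (z i).2 (r.2 : EuclideanSpace ℝ (Fin N)) : ℝ))|) := by fun_prop
  exact this.measurable.pow_const _

instance (N : ℕ) : IsFiniteMeasure (sphMeasure N) := by
  unfold sphMeasure; infer_instance

instance (N : ℕ) : (sphMeasure N).IsOpenPosMeasure := by
  unfold sphMeasure; infer_instance

set_option maxHeartbeats 400000 in
lemma key_bound (N : ℕ) (hN : 1 ≤ N) (α : ℝ) (hα0 : 0 < α) :
    ∃ K : ℝ, 0 ≤ K ∧ ∀ n : ℕ, 1 ≤ n → ∀ z : Fin n → ℝ × EuclideanSpace ℝ (Fin N),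
      ∀ R : ℝ, 0 < R →
      volume {q : ℝ × EuclideanSpace ℝ (Fin N) | (∫⁻ w, ENNReal.ofReal
                  (⨅ i, |(q.1 + (inner ℝ q.2 (w : EuclideanSpace ℝ (Fin N)) : ℝ)) -
                      ((z i).1 + (inner ℝ (z i).2 (w : EuclideanSpace ℝ (Fin N)) : ℝ))| ^
                    (2 * α)) ∂(sphMeasure N)) ≤ ENNReal.ofReal R} ≤
        ENNReal.ofReal (K * (n : ℝ) ^ (1 + N : ℝ) * R ^ ((1 + N : ℝ) / (2 * α))) := by
  obtain ⟨c, hc, U, hU, hdet⟩ := exists_nbhd N hN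
  obtain ⟨k0, hk0⟩ := Finite.exists_min (fun k => (sphMeasure N (U k)).toReal)
  set m := (sphMeasure N (U k0)).toReal with hm
  have hm0 : 0 < m := ENNReal.toReal_pos ((hU k0).1.measure_ne_zero _ (hU k0).2)
    (measure_ne_top _ _)
  have hmU : ∀ k, ENNReal.ofReal m ≤ sphMeasure N (U k) := fun k =>
    ENNReal.ofReal_le_of_le_toReal (hk0 k)
  set π := Measure.pi (fun _ : Fin (N + 1) => sphMeasure N) with hπ
  set M := 2 / m with hM
  have hM0 : 0 < M := by positivity
  set T := (π univ).toReal with hT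
  have hT' : π univ = ENNReal.ofReal T := (ENNReal.ofReal_toReal (measure_ne_top _ _)).symm
  have hT0 : 0 ≤ T := ENNReal.toReal_nonneg
  refine ⟨T * (c⁻¹ * (2 * M ^ (1 / (2 * α))) ^ (N + 1)) / (m / 2) ^ (N + 1), by positivity, ?_⟩
  intro n hn z R hR
  have : Nonempty (Fin n) := ⟨⟨0, hn⟩⟩
  have hg := measurable_g N n α z
  set g : ℝ × EuclideanSpace ℝ (Fin N) → Metric.sphere (0 : EuclideanSpace ℝ (Fin N)) 1 → ℝ :=
    fun q w => ⨅ i, |(q.1 + (inner ℝ q.2 (w : EuclideanSpace ℝ (Fin N)) : ℝ)) -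
      ((z i).1 + (inner ℝ (z i).2 (w : EuclideanSpace ℝ (Fin N)) : ℝ))| ^ (2 * α) with hgdef
  change Measurable (fun r : (ℝ × EuclideanSpace ℝ (Fin N)) ×
        Metric.sphere (0 : EuclideanSpace ℝ (Fin N)) 1 => ENNReal.ofReal (g r.1 r.2)) at hg
  change volume {q | ∫⁻ w, ENNReal.ofReal (g q w) ∂(sphMeasure N) ≤ ENNReal.ofReal R} ≤ _
  have hgi : ∀ q (w : Metric.sphere (0 : EuclideanSpace ℝ (Fin N)) 1), ∃ i, |(q.1 + (inner ℝ q.2 (w : EuclideanSpace ℝ (Fin N)) : ℝ)) -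
      ((z i).1 + (inner ℝ (z i).2 (w : EuclideanSpace ℝ (Fin N)) : ℝ))| ^ (2 * α) = g q w :=
    fun q w => exists_eq_ciInf_of_finite
  clear_value g
  set P : Set ((ℝ × EuclideanSpace ℝ (Fin N)) ×
      (Fin (N + 1) → Metric.sphere (0 : EuclideanSpace ℝ (Fin N)) 1)) :=
    {r | ∀ k, r.2 k ∈ U k ∧ ENNReal.ofReal (g r.1 (r.2 k)) < ENNReal.ofReal (M * R)} with hP
  have hPm : MeasurableSet P := by
    rw [hP, ofPred_forall]
    refine MeasurableSet.iInter fun k => ?_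
    have hk : Measurable (fun r : (ℝ × EuclideanSpace ℝ (Fin N)) ×
      (Fin (N + 1) → Metric.sphere (0 : EuclideanSpace ℝ (Fin N)) 1) => r.2 k) := by fun_prop
    refine MeasurableSet.inter (hk (hU k).1.measurableSet) ?_
    exact measurableSet_lt (hg.comp (measurable_fst.prodMk hk)) measurable_const
  have hGm : Measurable fun q => ∫⁻ w, ENNReal.ofReal (g q w) ∂(sphMeasure N) :=
    hg.lintegral_prod_right'
  have hSm : MeasurableSet
      {q | ∫⁻ w, ENNReal.ofReal (g q w) ∂(sphMeasure N) ≤ ENNReal.ofReal R} :=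
    measurableSet_le hGm measurable_const
  set v : ℝ := n * (2 * M ^ (1 / (2 * α)) * R ^ (1 / (2 * α))) with hv
  have hv0 : 0 ≤ v := by positivity
  -- lower bound
  have low : volume {q | ∫⁻ w, ENNReal.ofReal (g q w) ∂(sphMeasure N) ≤ ENNReal.ofReal R} *
      ENNReal.ofReal ((m / 2) ^ (N + 1)) ≤ (volume.prod π) P := by
    rw [Measure.prod_apply hPm, mul_comm, ← setLIntegral_const]
    refine le_trans ?_ (setLIntegral_le_lintegral
      {q | ∫⁻ w, ENNReal.ofReal (g q w) ∂(sphMeasure N) ≤ ENNReal.ofReal R} _)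
    refine setLIntegral_mono' hSm ?_
    intro q hq
    have hgq : Measurable (fun w => ENNReal.ofReal (g q w)) := hg.comp measurable_prodMk_left
    have hbad : sphMeasure N {w | ENNReal.ofReal (M * R) ≤ ENNReal.ofReal (g q w)} ≤
        ENNReal.ofReal (m / 2) := by
      have h1 := (mul_meas_ge_le_lintegral (μ := sphMeasure N) hgq
        (ENNReal.ofReal (M * R))).trans hq
      have hMR : ENNReal.ofReal (M * R) ≠ 0 := by
        simp only [ne_eq, ENNReal.ofReal_eq_zero, not_le]; positivity
      rw [mul_comm, ← ENNReal.le_div_iff_mul_le (Or.inl hMR) (Or.inl ENNReal.ofReal_ne_top),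
        ← ENNReal.ofReal_div_of_pos (by positivity)] at h1
      refine h1.trans (le_of_eq ?_)
      congr 1
      rw [hM]; field_simp
    have hsub : univ.pi (fun k => U k \ {w | ENNReal.ofReal (M * R) ≤ ENNReal.ofReal (g q w)}) ⊆
        Prod.mk q ⁻¹' P := by
      intro W hW k
      have := hW k (mem_univ _)
      exact ⟨this.1, not_le.1 this.2⟩
    refine le_trans ?_ (measure_mono hsub)
    rw [hπ, Measure.pi_pi, ENNReal.ofReal_pow (by positivity)]
    calc ENNReal.ofReal (m / 2) ^ (N + 1) = ∏ k : Fin (N + 1), ENNReal.ofReal (m / 2) := by simp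
      _ ≤ _ := by
        refine Finset.prod_le_prod' fun k _ => ?_
        refine le_trans ?_ le_measure_sdiff
        calc ENNReal.ofReal (m / 2) = ENNReal.ofReal m - ENNReal.ofReal (m / 2) := by
              rw [← ENNReal.ofReal_sub _ (by positivity)]; congr 1; ring
          _ ≤ _ := tsub_le_tsub (hmU k) hbad
  have up : (volume.prod π) P ≤ ENNReal.ofReal (c⁻¹ * v ^ (N + 1) * T) := by
    rw [Measure.prod_apply_symm hPm]
    calc _ ≤ ∫⁻ W, ENNReal.ofReal (c⁻¹ * v ^ (N + 1)) ∂π := by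
          refine lintegral_mono fun W => ?_
          by_cases hW : ∀ k, W k ∈ U k
          · set A : Fin (N + 1) → Set ℝ := fun k => ⋃ i : Fin n,
              Metric.closedBall ((z i).1 +
                inner ℝ (z i).2 (W k : EuclideanSpace ℝ (Fin N))) ((M * R) ^ (1 / (2 * α))) with hA
            have hb := volume_box_preimage N (fun k => (W k : EuclideanSpace ℝ (Fin N))) c hc
              (hdet W hW) A (fun k => MeasurableSet.iUnion fun i => measurableSet_closedBall)
              (ENNReal.ofReal v) (by
                intro k
                refine (measure_iUnion_le _).trans ?_
                simp only [Real.volume_closedBall]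
                rw [tsum_fintype, Finset.sum_const, Finset.card_univ, Fintype.card_fin,
                  nsmul_eq_mul, ← ENNReal.ofReal_natCast, ← ENNReal.ofReal_mul (by positivity),
                  hv, Real.mul_rpow hM0.le hR.le, mul_assoc])
            rw [← ENNReal.ofReal_pow hv0, ← ENNReal.ofReal_mul (by positivity)] at hb
            refine le_trans (measure_mono ?_) hb
            intro q hq k
            have h2 := (hq k).2
            rw [ENNReal.ofReal_lt_ofReal_iff (by positivity)] at h2
            obtain ⟨i, hi⟩ := hgi q (W k)
            refine mem_iUnion.2 ⟨i, ?_⟩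
            rw [Metric.mem_closedBall, Real.dist_eq]
            have h3 : |(q.1 + (inner ℝ q.2 (W k : EuclideanSpace ℝ (Fin N)) : ℝ)) -
              ((z i).1 + (inner ℝ (z i).2 (W k : EuclideanSpace ℝ (Fin N)) : ℝ))| ^ (2 * α)
                ≤ M * R := hi.trans_le h2.le
            have h4 := Real.rpow_le_rpow (by positivity) h3
              (by positivity : 0 ≤ 1 / (2 * α))
            rwa [← Real.rpow_mul (abs_nonneg _), mul_one_div_cancel (by positivity),
              Real.rpow_one] at h4
          · have : (fun x => (x, W)) ⁻¹' P = ∅ := by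
              ext q
              simp only [mem_preimage, mem_empty_iff_false, iff_false]
              intro hq
              exact hW fun k => (hq k).1
            rw [this]; simp
      _ = _ := by
          rw [lintegral_const, hT', ← ENNReal.ofReal_mul (by positivity)]
  have fin := low.trans up
  have hpos : (0 : ℝ) < (m / 2) ^ (N + 1) := by positivity
  rw [← ENNReal.le_div_iff_mul_le (Or.inl (by simpa using hpos)) (Or.inl ENNReal.ofReal_ne_top),
    ← ENNReal.ofReal_div_of_pos hpos] at fin
  refine fin.trans (le_of_eq ?_)
  congr 1
  have e1 : (n : ℝ) ^ (1 + N : ℝ) = (n : ℝ) ^ (N + 1) := by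
    rw [← Real.rpow_natCast]; push_cast; rw [add_comm]
  have e2 : R ^ ((1 + N : ℝ) / (2 * α)) = (R ^ (1 / (2 * α))) ^ (N + 1) := by
    rw [← Real.rpow_natCast, ← Real.rpow_mul hR.le]; push_cast; congr 1; ring
  rw [e1, e2, hv]
  ring

lemma layer_bound {X : Type*} [MeasurableSpace X] (μ : Measure X) (G : X → ℝ≥0∞)
    (hG : Measurable G) (K A V d α p : ℝ) (hK : 0 ≤ K) (hA : 0 < A) (hV : 0 < V)
    (hα : 0 < α) (hp : 0 < p) (hd : α * p < d) (hμ : μ univ ≤ ENNReal.ofReal V)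
    (hb : ∀ R : ℝ, 0 < R → μ {x | G x ≤ ENNReal.ofReal R} ≤
      ENNReal.ofReal (K * A ^ d * R ^ (d / (2 * α)))) :
    ∫⁻ x, G x ^ (-(p / 2)) ∂μ ≤
      ENNReal.ofReal ((1 + K * (α * p / (d - α * p))) * A ^ (α * p)) *
        ENNReal.ofReal V ^ (1 - α * p / d) := by
  have ha : 0 < α * p := mul_pos hα hp
  have hd0 : 0 < d := ha.trans hd
  have hβ : 1 < d / (α * p) := by rwa [one_lt_div ha]
  have h0 : μ {x | G x = 0} = 0 := by
    have ht : Filter.Tendsto (fun R : ℝ => ENNReal.ofReal (K * A ^ d * R ^ (d / (2 * α))))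
        (nhdsWithin 0 (Ioi 0)) (nhds (ENNReal.ofReal (K * A ^ d * (0:ℝ) ^ (d / (2 * α))))) := by
      apply Filter.Tendsto.mono_left _ nhdsWithin_le_nhds
      apply ENNReal.tendsto_ofReal
      apply Filter.Tendsto.const_mul
      exact (Real.continuousAt_rpow_const _ _ (Or.inr (by positivity))).tendsto
    rw [Real.zero_rpow (by positivity), mul_zero, ENNReal.ofReal_zero] at ht
    refine le_antisymm (ge_of_tendsto ht ?_) (by simp)
    filter_upwards [self_mem_nhdsWithin] with R hR
    refine (measure_mono ?_).trans (hb R hR)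
    intro x hx
    simp only [mem_ofPred_eq] at hx ⊢
    simp [hx]
  have hae : ∀ᵐ x ∂μ, G x ≠ 0 := by
    rw [ae_iff]; simpa using h0
  have hfm : Measurable fun x => (G x ^ (-(p / 2))) := by fun_prop
  have hcongr : ∫⁻ x, G x ^ (-(p / 2)) ∂μ =
      ∫⁻ x, ENNReal.ofReal ((G x ^ (-(p / 2))).toReal) ∂μ := by
    apply lintegral_congr_ae
    filter_upwards [hae] with x hx
    rw [ENNReal.ofReal_toReal]
    rw [ENNReal.rpow_neg]
    simp [ENNReal.rpow_eq_zero_iff, hx, not_lt.2 (half_pos hp).le]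
  rw [hcongr, lintegral_eq_lintegral_meas_lt μ (Filter.Eventually.of_forall fun x => by
    simp) hfm.ennreal_toReal.aemeasurable]
  have hmeas : ∀ t : ℝ, 0 < t → μ {x | t < (G x ^ (-(p / 2))).toReal} ≤
      ENNReal.ofReal (K * A ^ d * t ^ (-(d / (α * p)))) := by
    intro t ht
    have h1 := hb (t ^ (-(2 / p))) (by positivity)
    rw [← Real.rpow_mul ht.le] at h1
    have : -(2 / p) * (d / (2 * α)) = -(d / (α * p)) := by field_simp
    rw [this] at h1
    refine (measure_mono ?_).trans h1
    intro x hx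
    simp only [mem_ofPred_eq] at hx ⊢
    by_contra hlt
    push Not at hlt
    have h2 : G x ^ (-(p / 2)) ≤ ENNReal.ofReal t := by
      calc G x ^ (-(p / 2)) ≤ (ENNReal.ofReal (t ^ (-(2 / p)))) ^ (-(p / 2)) := by
            rw [ENNReal.rpow_neg, ENNReal.rpow_neg]
            gcongr
        _ = ENNReal.ofReal t := by
            rw [ENNReal.ofReal_rpow_of_pos (by positivity), ← Real.rpow_mul ht.le]
            have : -(2 / p) * (-(p / 2)) = 1 := by field_simp
            rw [this, Real.rpow_one]
    have h3 := ENNReal.toReal_mono ENNReal.ofReal_ne_top h2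
    rw [ENNReal.toReal_ofReal ht.le] at h3
    linarith
  set s := A ^ (α * p) * V ^ (-(α * p / d)) with hs
  have hs0 : 0 < s := by positivity
  rw [← Ioc_union_Ioi_eq_Ioi hs0.le]
  refine (lintegral_union_le _ _ _).trans ?_
  have e1 : ∫⁻ t in Ioc 0 s, μ {x | t < (G x ^ (-(p / 2))).toReal} ≤
      ENNReal.ofReal (A ^ (α * p) * V ^ (1 - α * p / d)) := by
    calc _ ≤ ∫⁻ t in Ioc 0 s, ENNReal.ofReal V :=
          lintegral_mono fun t => (measure_mono (subset_univ _)).trans hμ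
      _ = ENNReal.ofReal (V * s) := by
          rw [setLIntegral_const, Real.volume_Ioc, sub_zero, ENNReal.ofReal_mul hV.le]
      _ = _ := by
          congr 1
          rw [hs, sub_eq_add_neg, Real.rpow_add hV, Real.rpow_one]; ring
  have e2 : ∫⁻ t in Ioi s, μ {x | t < (G x ^ (-(p / 2))).toReal} ≤
      ENNReal.ofReal (K * (α * p / (d - α * p)) * (A ^ (α * p) * V ^ (1 - α * p / d))) := by
    calc _ ≤ ∫⁻ t in Ioi s, ENNReal.ofReal (K * A ^ d * t ^ (-(d / (α * p)))) := by
          apply setLIntegral_mono (by fun_prop)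
          intro t ht
          exact hmeas t (hs0.trans ht)
      _ = ENNReal.ofReal (∫ t in Ioi s, K * A ^ d * t ^ (-(d / (α * p)))) := by
          rw [ofReal_integral_eq_lintegral_ofReal]
          · exact (integrableOn_Ioi_rpow_of_lt (by linarith) hs0).const_mul _
          · rw [Filter.EventuallyLE, ae_restrict_iff' measurableSet_Ioi]
            filter_upwards with t ht
            have : 0 < t := hs0.trans ht
            simp only [Pi.zero_apply]
            positivity
      _ = _ := by
          rw [integral_const_mul, integral_Ioi_rpow_of_lt (by linarith) hs0]
          congr 1
          have e3 : s ^ (-(d / (α * p)) + 1) = A ^ (α * p) * A ^ (-d) * V ^ (1 - α * p / d) := by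
            rw [hs, Real.mul_rpow (by positivity) (by positivity), ← Real.rpow_mul hA.le,
              ← Real.rpow_mul hV.le, ← Real.rpow_add hA]
            congr 2
            · field_simp; ring
            · field_simp; ring
          rw [e3]
          have e4 : A ^ d * A ^ (-d) = 1 := by
            rw [← Real.rpow_add hA]; simp
          have hne : d - α * p ≠ 0 := by linarith
          have e5 : -(d / (α * p)) + 1 = -((d - α * p) / (α * p)) := by
            field_simp; ring
          rw [e5, neg_div_neg_eq]
          calc _ = K * (A ^ d * A ^ (-d)) * (A ^ (α * p) * V ^ (1 - α * p / d)) /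
                ((d - α * p) / (α * p)) := by ring
            _ = _ := by rw [e4]; field_simp
  refine (add_le_add e1 e2).trans (le_of_eq ?_)
  have hnn : 0 ≤ α * p / (d - α * p) := div_nonneg ha.le (by linarith)
  rw [ENNReal.ofReal_rpow_of_pos hV, ← ENNReal.ofReal_add (by positivity) (by positivity),
    ← ENNReal.ofReal_mul (by positivity)]
  congr 1
  ring

/-- Lemma 4.2: if `αp < 1 + N`, then for all compact subintervals `I` of a fixed compact
interval `T ⊂ ℝ^{1+N}` and points `(t¹,x¹), …, (tⁿ,xⁿ) ∈ I`,
`∫_I [∫_{S^{N−1}} min_i |(t + ⟨x,w⟩) − (t^i + ⟨x^i,w⟩)|^{2α} dσ(w)]^{−p/2} dt dx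
  ≤ C n^{αp} λ_{1+N}(I)^{1 − αp/(1+N)}`. -/
theorem spherical_min_integral_estimate
    (N : ℕ) (hN : 1 ≤ N) (α p : ℝ) (hα0 : 0 < α) (hα1 : α < 1) (hp : 0 < p)
    (hαp : α * p < 1 + N)
    (Ta Tb : ℝ) (Xa Xb : Fin N → ℝ) :
    ∃ C : ℝ, 0 < C ∧
      ∀ (ia ib : ℝ) (ja jb : Fin N → ℝ),
        {q : ℝ × EuclideanSpace ℝ (Fin N) |
            q.1 ∈ Icc ia ib ∧ ∀ i, q.2 i ∈ Icc (ja i) (jb i)} ⊆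
          {q : ℝ × EuclideanSpace ℝ (Fin N) |
            q.1 ∈ Icc Ta Tb ∧ ∀ i, q.2 i ∈ Icc (Xa i) (Xb i)} →
        ∀ n : ℕ, 1 ≤ n →
          ∀ z : Fin n → ℝ × EuclideanSpace ℝ (Fin N),
            (∀ j, (z j).1 ∈ Icc ia ib ∧ ∀ i, (z j).2 i ∈ Icc (ja i) (jb i)) →
            (∫⁻ q in {q : ℝ × EuclideanSpace ℝ (Fin N) |
                q.1 ∈ Icc ia ib ∧ ∀ i, q.2 i ∈ Icc (ja i) (jb i)},
              (∫⁻ w, ENNReal.ofReal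
                  (⨅ i, |(q.1 + (inner ℝ q.2 (w : EuclideanSpace ℝ (Fin N)) : ℝ)) -
                      ((z i).1 + (inner ℝ (z i).2 (w : EuclideanSpace ℝ (Fin N)) : ℝ))| ^
                    (2 * α)) ∂(sphMeasure N)) ^ (-(p / 2))) ≤
              ENNReal.ofReal (C * (n : ℝ) ^ (α * p)) *
                (volume {q : ℝ × EuclideanSpace ℝ (Fin N) |
                    q.1 ∈ Icc ia ib ∧ ∀ i, q.2 i ∈ Icc (ja i) (jb i)}) ^
                  (1 - α * p / (1 + N)) := by
  obtain ⟨K, hK, hkey⟩ := key_bound N hN α hα0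
  have hnn : 0 ≤ α * p / ((1 + N : ℝ) - α * p) :=
    div_nonneg (mul_pos hα0 hp).le (by linarith)
  refine ⟨1 + K * (α * p / ((1 + N : ℝ) - α * p)), by positivity, ?_⟩
  intro ia ib ja jb _ n hn z _
  set I := {q : ℝ × EuclideanSpace ℝ (Fin N) |
            q.1 ∈ Icc ia ib ∧ ∀ i, q.2 i ∈ Icc (ja i) (jb i)} with hI
  have hfin : volume I ≠ ∞ := by
    have hset : I = (Icc ia ib) ×ˢ ((WithLp.ofLp : EuclideanSpace ℝ (Fin N) → (Fin N → ℝ)) ⁻¹'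
        (univ.pi fun i : Fin N => Icc (ja i) (jb i))) := by
      ext q
      simp only [hI, mem_ofPred_eq, mem_prod, mem_preimage, mem_pi, mem_univ, true_implies]
    have hbox : volume ((WithLp.ofLp : EuclideanSpace ℝ (Fin N) → (Fin N → ℝ)) ⁻¹'
        (univ.pi fun i : Fin N => Icc (ja i) (jb i))) =
        volume (univ.pi fun i : Fin N => Icc (ja i) (jb i)) :=
      (EuclideanSpace.volume_preserving_symm_measurableEquiv_toLp (Fin N)).measure_preimage
        (MeasurableSet.univ_pi fun i : Fin N => measurableSet_Icc).nullMeasurableSet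
    rw [hset, Measure.volume_eq_prod, Measure.prod_prod, hbox, volume_pi_pi]
    refine ENNReal.mul_ne_top (by simp) (ENNReal.prod_ne_top fun i _ => by simp)
  by_cases h0 : volume I = 0
  · rw [Measure.restrict_eq_zero.2 h0, lintegral_zero_measure]
    exact zero_le
  have hV : 0 < (volume I).toReal := ENNReal.toReal_pos h0 hfin
  have hVe : volume I = ENNReal.ofReal (volume I).toReal := (ENNReal.ofReal_toReal hfin).symm
  rw [hVe]
  refine layer_bound (volume.restrict I) _ (measurable_g N n α z).lintegral_prod_right' K n _
    (1 + N) α p hK (by exact_mod_cast hn) hV hα0 hp hαp ?_ ?_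
  · rw [Measure.restrict_apply_univ, ← hVe]
  · intro R hR
    exact (Measure.restrict_apply_le _ _).trans (hkey n hn z R hR)
end

section
/- (Cuzick–DuPreez Gaussian integral identity.) Let E be a real inner product space, let v₁, …, vₙ ∈ E be linearly independent, and let g : ℝ → ℝ be a measurable function such that ∫_ℝ |g(x)| e^{−εx²} dx < ∞ for every ε > 0. Then ∫_{ℝⁿ} g(ξ₁) exp( −(1/2) ‖ Σ_{j=1}^n ξ_j v_j ‖² ) dξ₁ ⋯ dξₙ = (2π)^{(n−1)/2} (det Γ)^{−1/2} ∫_ℝ g(x / V₁) e^{−x²/2} dx, where Γ is the n × n Gram matrix with entries Γ_{ij} = ⟨v_i, v_j⟩ and V₁ = dist(v₁, span{v₂, …, vₙ}) is the distance from v₁ to the linear span of v₂, …, vₙ (with V₁ = ‖v₁‖ when n = 1). -/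
open MeasureTheory Set
open scoped ENNReal

lemma cdp_proj {E : Type*} [NormedAddCommGroup E] [InnerProductSpace ℝ E]
    {m : ℕ} (v : Fin (m + 1) → E) (hv : LinearIndependent ℝ v) :
    ∃ (c : Fin m → ℝ) (u : E), v 0 = u + ∑ j, c j • v j.succ ∧
      (∀ j : Fin m, inner ℝ u (v j.succ) = 0) ∧ u ≠ 0 ∧
      Metric.infDist (v 0) (Submodule.span ℝ (v '' {j | j ≠ 0})) = ‖u‖ := by
  have hset : v '' {j | j ≠ 0} = range (fun j : Fin m => v j.succ) := by
    ext x
    constructor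
    · rintro ⟨j, hj, rfl⟩
      exact ⟨j.pred hj, by simp⟩
    · rintro ⟨j, rfl⟩
      exact ⟨j.succ, Fin.succ_ne_zero j, rfl⟩
  have hnot : v 0 ∉ Submodule.span ℝ (v '' {j | j ≠ 0}) :=
    hv.notMem_span_image (by simp)
  rw [hset] at hnot ⊢
  set K := Submodule.span ℝ (range (fun j : Fin m => v j.succ)) with hK
  have : FiniteDimensional ℝ K := FiniteDimensional.span_of_finite ℝ (finite_range _)
  have hmem : K.starProjection (v 0) ∈ K := Submodule.starProjection_apply_mem K _
  obtain ⟨c, hc⟩ := (Submodule.mem_span_range_iff_exists_fun ℝ).1 hmem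
  refine ⟨c, v 0 - K.starProjection (v 0), ?_, ?_, ?_, ?_⟩
  · rw [hc]; abel
  · intro j
    exact K.starProjection_inner_eq_zero (v 0) _ (Submodule.subset_span ⟨j, rfl⟩)
  · intro h
    rw [sub_eq_zero] at h
    exact hnot (h ▸ hmem)
  · rw [Submodule.starProjection_minimal, Metric.infDist_eq_iInf]
    simp [dist_eq_norm]

lemma cdp_det {E : Type*} [NormedAddCommGroup E] [InnerProductSpace ℝ E]
    {m : ℕ} (v : Fin (m + 1) → E) (c : Fin m → ℝ) (u : E)
    (h0 : v 0 = u + ∑ j, c j • v j.succ) (hu : ∀ j : Fin m, inner ℝ u (v j.succ) = 0) :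
    (Matrix.gram ℝ v).det = ‖u‖ ^ 2 * (Matrix.gram ℝ (fun j : Fin m => v j.succ)).det := by
  have h := Matrix.det_updateRow_sum (Matrix.gram ℝ v) 0 (Fin.cons 1 (fun j => - c j))
  simp only [Fin.cons_zero, one_smul] at h
  rw [← h]
  have hrow : (∑ k, (Fin.cons 1 (fun j => - c j) : Fin (m + 1) → ℝ) k • Matrix.gram ℝ v k)
      = fun k => inner ℝ u (v k) := by
    ext k
    have : u = v 0 - ∑ j, c j • v j.succ := by rw [h0]; abel
    rw [this, inner_sub_left, sum_inner]
    simp [Fin.sum_univ_succ, Matrix.gram_apply, inner_smul_left,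
      Finset.sum_apply, sub_eq_add_neg]
  rw [hrow, Matrix.det_succ_row_zero, Fin.sum_univ_succ]
  have h00 : inner ℝ u (v 0) = ‖u‖ ^ 2 := by
    rw [h0, inner_add_right, inner_sum]
    simp [inner_smul_right, hu]
  simp only [Matrix.updateRow_self, hu, h00]
  simp
  left
  congr 1

lemma cdp_red {E : Type*} [NormedAddCommGroup E] [InnerProductSpace ℝ E]
    {m : ℕ} (v : Fin (m + 1) → E) (c : Fin m → ℝ) (u : E)
    (h0 : v 0 = u + ∑ j, c j • v j.succ) (hu : ∀ j : Fin m, inner ℝ u (v j.succ) = 0)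
    (g : ℝ → ℝ) (hg : Measurable g) :
    ∫ ξ : Fin (m + 1) → ℝ, g (ξ 0) * Real.exp (-(1 / 2) * ‖∑ j, ξ j • v j‖ ^ 2) =
      (∫ x : ℝ, g x * Real.exp (-(1 / 2) * (‖u‖ * x) ^ 2)) *
      ∫ η : Fin m → ℝ, Real.exp (-(1 / 2) * ‖∑ j, η j • v j.succ‖ ^ 2) := by
  have hem := (volume_preserving_piFinSuccAbove (fun _ : Fin (m + 1) => ℝ) 0).symm
  rw [← hem.integral_comp']
  have hsh : MeasurePreserving (fun p : ℝ × (Fin m → ℝ) => (p.1, p.1 • c + p.2))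
      ((volume : Measure ℝ).prod (volume : Measure (Fin m → ℝ)))
      ((volume : Measure ℝ).prod (volume : Measure (Fin m → ℝ))) := by
    refine (MeasurePreserving.id _).skew_product (g := fun x η => x • c + η) ?_ ?_
    · exact Continuous.measurable (by unfold Function.uncurry; fun_prop)
    · exact Filter.Eventually.of_forall fun x => map_add_left_eq_self _ _
  rw [← integral_prod_mul, ← hsh.map_eq, integral_map hsh.aemeasurable]
  · rw [← Measure.volume_eq_prod]
    refine integral_congr_ae (Filter.Eventually.of_forall ?_)
    rintro ⟨x, η⟩
    have hs : ∑ j, ((MeasurableEquiv.piFinSuccAbove (fun _ : Fin (m + 1) => ℝ) 0).symm (x, η)) j • v j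
        = x • u + ∑ j, (x • c + η) j • v j.succ := by
      simp [MeasurableEquiv.piFinSuccAbove_symm_apply, Fin.insertNthEquiv, Fin.sum_univ_succ, h0,
        add_smul, Finset.sum_add_distrib, Finset.smul_sum, mul_smul, add_assoc]
    have hn : ‖x • u + ∑ j, (x • c + η) j • v j.succ‖ ^ 2 =
        (‖u‖ * x) ^ 2 + ‖∑ j, (x • c + η) j • v j.succ‖ ^ 2 := by
      have := norm_add_sq_eq_norm_sq_add_norm_sq_real
        (x := x • u) (y := ∑ j, (x • c + η) j • v j.succ)
        (by simp [inner_sum, inner_smul_left, inner_smul_right, hu])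
      rw [sq, this, norm_smul, Real.norm_eq_abs]
      linear_combination ‖u‖ ^ 2 * abs_mul_abs_self x
    simp only [hs, hn, mul_add, Real.exp_add]
    simp [MeasurableEquiv.piFinSuccAbove_symm_apply, Fin.insertNthEquiv, mul_assoc]
  · rw [hsh.map_eq]
    refine Measurable.aestronglyMeasurable ?_
    refine Measurable.mul (by fun_prop) ?_
    exact Continuous.measurable (by fun_prop)

lemma cdp_scale (g : ℝ → ℝ) (V : ℝ) (hV : 0 < V) :
    ∫ x : ℝ, g x * Real.exp (-(1 / 2) * (V * x) ^ 2) =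
      V⁻¹ * ∫ x : ℝ, g (x / V) * Real.exp (-x ^ 2 / 2) := by
  have h := Measure.integral_comp_div (fun x => g x * Real.exp (-(1 / 2) * (V * x) ^ 2)) V
  have h2 : ∀ x : ℝ, g (x / V) * Real.exp (-x ^ 2 / 2) =
      g (x / V) * Real.exp (-(1 / 2) * (V * (x / V)) ^ 2) := by
    intro x
    rw [mul_div_cancel₀ x hV.ne']
    ring_nf
  simp_rw [h2]
  rw [h, abs_of_pos hV, smul_eq_mul, inv_mul_cancel_left₀ hV.ne']

lemma cdp_rpow {V d : ℝ} (hV : 0 < V) (hd : 0 < d) :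
    (V ^ 2 * d) ^ (-(1 / 2) : ℝ) = V⁻¹ * d ^ (-(1 / 2) : ℝ) := by
  rw [Real.mul_rpow (by positivity) hd.le, ← Real.rpow_natCast, ← Real.rpow_mul hV.le]
  norm_num [Real.rpow_neg_one]

lemma cdp_gauss {E : Type*} [NormedAddCommGroup E] [InnerProductSpace ℝ E] (m : ℕ) :
    ∀ v : Fin m → E, LinearIndependent ℝ v →
    ∫ η : Fin m → ℝ, Real.exp (-(1 / 2) * ‖∑ j, η j • v j‖ ^ 2) =
      (2 * Real.pi) ^ ((m : ℝ) / 2) * (Matrix.gram ℝ v).det ^ (-(1 / 2) : ℝ) := by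
  induction m with
  | zero =>
    intro v _
    simp [measureReal_def, volume_pi]
  | succ m ih =>
    intro v hv
    obtain ⟨c, u, h0, hu, hu0, -⟩ := cdp_proj v hv
    have hv' : LinearIndependent ℝ (fun j : Fin m => v j.succ) :=
      hv.comp _ (Fin.succ_injective m)
    have hV : 0 < ‖u‖ := norm_pos_iff.2 hu0
    have hd := (Matrix.posDef_gram_of_linearIndependent hv').det_pos
    have h := cdp_red v c u h0 hu (fun _ => 1) measurable_const
    rw [cdp_scale _ _ hV, ih _ hv'] at h
    simp only [one_mul] at h
    rw [h, cdp_det v c u h0 hu, cdp_rpow hV hd]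
    have hg : ∫ x : ℝ, Real.exp (-x ^ 2 / 2) = (2 * Real.pi) ^ ((1 : ℝ) / 2) := by
      have := integral_gaussian (1 / 2)
      rw [← Real.sqrt_eq_rpow]
      convert this using 3
      · ring_nf
      · ring
    rw [hg]
    push_cast
    rw [add_div, Real.rpow_add (by positivity)]
    ring

/-- Lemma 4.6 (Cuzick–DuPreez): for linearly independent vectors `v₁, …, vₙ` in a real
inner product space and a measurable `g : ℝ → ℝ` with `∫ |g(x)| e^{−εx²} dx < ∞` for all
`ε > 0`,
`∫_{ℝⁿ} g(ξ₁) exp(−(1/2)‖Σ ξ_j v_j‖²) dξ = (2π)^{(n−1)/2} (det Γ)^{−1/2} ∫ g(x/V₁) e^{−x²/2} dx`,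
where `Γ` is the Gram matrix of the `v_j` and `V₁` is the distance from `v₁` to the span
of `v₂, …, vₙ`. -/
theorem cuzick_dupreez_identity
    (E : Type*) [NormedAddCommGroup E] [InnerProductSpace ℝ E]
    (n : ℕ) (hn : 1 ≤ n) (v : Fin n → E) (hv : LinearIndependent ℝ v)
    (g : ℝ → ℝ) (hg : Measurable g)
    (hint : ∀ ε : ℝ, 0 < ε → Integrable (fun x : ℝ => |g x| * Real.exp (-ε * x ^ 2))) :
    ∫ ξ : Fin n → ℝ,
        g (ξ ⟨0, hn⟩) * Real.exp (-(1 / 2) * ‖∑ j, ξ j • v j‖ ^ 2) =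
      (2 * Real.pi) ^ (((n : ℝ) - 1) / 2) *
        (Matrix.det (Matrix.of fun i j : Fin n => (inner ℝ (v i) (v j) : ℝ))) ^ (-(1 / 2) : ℝ) *
        ∫ x : ℝ,
          g (x / Metric.infDist (v ⟨0, hn⟩)
              (Submodule.span ℝ (v '' {j | j ≠ ⟨0, hn⟩}))) *
            Real.exp (-x ^ 2 / 2) := by
  obtain ⟨m, rfl⟩ : ∃ m, n = m + 1 := ⟨n - 1, by omega⟩
  have hz : (⟨0, hn⟩ : Fin (m + 1)) = 0 := rfl
  rw [hz]
  obtain ⟨c, u, h0, hu, hu0, hdist⟩ := cdp_proj v hv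
  have hv' : LinearIndependent ℝ (fun j : Fin m => v j.succ) :=
    hv.comp _ (Fin.succ_injective m)
  have hV : 0 < ‖u‖ := norm_pos_iff.2 hu0
  have hd := (Matrix.posDef_gram_of_linearIndependent hv').det_pos
  have hdet := cdp_det v c u h0 hu
  rw [Matrix.gram] at hdet
  rw [hdist, hdet, cdp_rpow hV hd, cdp_red v c u h0 hu g hg, cdp_scale _ _ hV, cdp_gauss _ _ hv']
  push_cast
  rw [add_sub_cancel_right]
  ring
end
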